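/- For every coloring f : FIN_A → C into a finite set C, there exists a coloring g : FIN_A → C that is strongly proximal to f. -/

import Mathlib

namespace Carlson

/-- The domain of a partial function `ℕ →. B`, encoded as `ℕ → Option B`. -/
def dom {B : Type*} (p : ℕ → Option B) : Set ℕ := {n | p n ≠ none}

/-- `p` is a located word over `B`: a partial function with finite nonempty domain. -/
def IsLW {B : Type*} (p : ℕ → Option B) : Prop := (dom p).Finite ∧ (dom p).Nonempty

/-- A located variable word over `A` is a located word over `Option A`
(where `none` encodes the variable `⋆`) taking the value `⋆` at least once. -/
def IsLVW {A : Type*} (p : ℕ → Option (Option A)) : Prop :=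
  IsLW p ∧ ∃ n, p n = some none

/-- `p < q`: every element of the domain of `p` is below every element of the domain of `q`. -/
def blt {B : Type*} (p q : ℕ → Option B) : Prop :=
  ∀ m ∈ dom p, ∀ n ∈ dom q, m < n

/-- Union `p ∪ q` of two partial functions (`p` takes precedence; for `blt p q`
the domains are disjoint, so this is the genuine union). -/
def pun {B : Type*} (p q : ℕ → Option B) : ℕ → Option B :=
  fun n => (p n).elim (q n) some

/-- The empty partial function. -/
def emptyW {B : Type*} : ℕ → Option B := fun _ => none

/-- `p[a]`: substitution of the letter `a ∈ A` for the variable `⋆` in a located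
variable word. -/
def substA {A : Type*} (p : ℕ → Option (Option A)) (a : A) : ℕ → Option A :=
  fun n => (p n).map fun x => x.getD a

/-- `p[a]` for `a ∈ A ∪ {⋆}` (with `none` encoding `⋆`, so `p[⋆] = p`). -/
def substV {A : Type*} (p : ℕ → Option (Option A)) (a : Option A) : ℕ → Option (Option A) :=
  fun n => (p n).map fun x => x.elim a some

/-- Union of a finite family of partial functions with pairwise disjoint domains. -/
def famUnion {B : Type*} {k : ℕ} (g : Fin k → ℕ → Option B) : ℕ → Option B :=
  fun n => ((List.ofFn fun i => g i n).filterMap id).head?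

/-- A block sequence: a set of located variable words totally ordered by `<`. -/
def IsBlockSeq {A : Type*} (X : Set (ℕ → Option (Option A))) : Prop :=
  (∀ p ∈ X, IsLVW p) ∧ ∀ p ∈ X, ∀ q ∈ X, p = q ∨ blt p q ∨ blt q p

/-- `[X]_A`: located words of the form `p₀[a₀] ∪ ⋯ ∪ p_k[a_k]` with `p₀ < ⋯ < p_k`
all in `X` and `a₀, …, a_k ∈ A`. -/
def combA {A : Type*} (X : Set (ℕ → Option (Option A))) : Set (ℕ → Option A) :=
  { q | ∃ (k : ℕ) (p : Fin (k + 1) → ℕ → Option (Option A)) (a : Fin (k + 1) → A),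
      (∀ i, p i ∈ X) ∧ (∀ i j : Fin (k + 1), i < j → blt (p i) (p j)) ∧
      q = famUnion fun i => substA (p i) (a i) }

/-- `[X]_{A⋆}`: located variable words of the form `p₀[a₀] ∪ ⋯ ∪ p_k[a_k]` with
`p₀ < ⋯ < p_k` all in `X`, `a₀, …, a_k ∈ A ∪ {⋆}`, and `⋆` used at least once. -/
def combV {A : Type*} (X : Set (ℕ → Option (Option A))) : Set (ℕ → Option (Option A)) :=
  { q | ∃ (k : ℕ) (p : Fin (k + 1) → ℕ → Option (Option A)) (a : Fin (k + 1) → Option A),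
      (∀ i, p i ∈ X) ∧ (∀ i j : Fin (k + 1), i < j → blt (p i) (p j)) ∧
      (∃ i, a i = none) ∧ q = famUnion fun i => substV (p i) (a i) }

/-- `X − F`: the elements of `X` whose domain lies entirely above the domains of
all members of `F`. -/
def sminus {B : Type*} (X F : Set (ℕ → Option B)) : Set (ℕ → Option B) :=
  { q ∈ X | ∀ p ∈ F, blt p q }

/-- `dom q ⊆ [0, ℓ)`. -/
def domBelow {B : Type*} (q : ℕ → Option B) (ℓ : ℕ) : Prop := ∀ n ∈ dom q, n < ℓ

/-- `dom q ⊆ [m, ∞)`. -/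
def domAbove {B : Type*} (q : ℕ → Option B) (m : ℕ) : Prop := ∀ n ∈ dom q, m ≤ n

/-- `S^ℓ_p(f) = S^ℓ_{p'}(g)` for colorings of located words: agreement at `q ∪ p`
vs `q ∪ p'` for every located word `q` with domain contained in `[0, ℓ)`.
(Take `p' = emptyW` to express `S^ℓ_p(f) = S^ℓ(g)`.) -/
def SEq {A C : Type*} (f g : (ℕ → Option A) → C) (ℓ : ℕ) (p p' : ℕ → Option A) : Prop :=
  ∀ q : ℕ → Option A, IsLW q → domBelow q ℓ → f (pun q p) = g (pun q p')

/-- Variant of `SEq` for colorings that are also defined at the empty located word,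
i.e. `q` ranges over `FIN_A(0, ℓ) ∪ {∅}`. -/
def SEq0 {A C : Type*} (f g : (ℕ → Option A) → C) (ℓ : ℕ) (p p' : ℕ → Option A) : Prop :=
  ∀ q : ℕ → Option A, (dom q).Finite → domBelow q ℓ → f (pun q p) = g (pun q p')

/-- A coloring `f` is recurrent if for every `ℓ` there is a located variable word `p`
with domain in `[ℓ, ∞)` such that `S^ℓ_{p[a]}(f) = S^ℓ(f)` for every `a ∈ A`. -/
def Recurrent {A C : Type*} (f : (ℕ → Option A) → C) : Prop :=
  ∀ ℓ : ℕ, ∃ p : ℕ → Option (Option A), IsLVW p ∧ domAbove p ℓ ∧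
    ∀ a : A, SEq f f ℓ (substA p a) emptyW

/-- A coloring `f` is uniformly recurrent if for every `ℓ` there is `m > ℓ` such that
for every `p ∈ FIN_A(m, ∞)` there is `q ∈ FIN_A(ℓ, m)` with `S^ℓ_{q ∪ p}(f) = S^ℓ(f)`. -/
def UnifRecurrent {A C : Type*} (f : (ℕ → Option A) → C) : Prop :=
  ∀ ℓ : ℕ, ∃ m : ℕ, ℓ < m ∧ ∀ p : ℕ → Option A, IsLW p → domAbove p m →
    ∃ q : ℕ → Option A, IsLW q ∧ domAbove q ℓ ∧ domBelow q m ∧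
      SEq f f ℓ (pun q p) emptyW

/-- `f` and `g` are weakly proximal: for every `ℓ` there is `p ∈ FIN_A(ℓ, ∞)` with
`S^ℓ_p(f) = S^ℓ_p(g)`. -/
def WeakProx {A C : Type*} (f g : (ℕ → Option A) → C) : Prop :=
  ∀ ℓ : ℕ, ∃ p : ℕ → Option A, IsLW p ∧ domAbove p ℓ ∧ SEq f g ℓ p p

/-- `g` is strongly proximal to `f`: for every `ℓ` there is a located variable word `p`
with domain in `[ℓ, ∞)` such that `S^ℓ(g) = S^ℓ_{p[a]}(g) = S^ℓ_{p[a]}(f)` for all `a ∈ A`. -/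
def StrongProx {A C : Type*} (g f : (ℕ → Option A) → C) : Prop :=
  ∀ ℓ : ℕ, ∃ p : ℕ → Option (Option A), IsLVW p ∧ domAbove p ℓ ∧
    ∀ a : A, SEq g g ℓ emptyW (substA p a) ∧ SEq g f ℓ (substA p a) (substA p a)

/-- `Recurrent` for colorings also defined at the empty located word. -/
def Recurrent0 {A C : Type*} (f : (ℕ → Option A) → C) : Prop :=
  ∀ ℓ : ℕ, ∃ p : ℕ → Option (Option A), IsLVW p ∧ domAbove p ℓ ∧
    ∀ a : A, SEq0 f f ℓ (substA p a) emptyW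

/-- `StrongProx` for colorings also defined at the empty located word. -/
def StrongProx0 {A C : Type*} (g f : (ℕ → Option A) → C) : Prop :=
  ∀ ℓ : ℕ, ∃ p : ℕ → Option (Option A), IsLVW p ∧ domAbove p ℓ ∧
    ∀ a : A, SEq0 g g ℓ emptyW (substA p a) ∧ SEq0 g f ℓ (substA p a) (substA p a)

/-- Agreement of two colorings on all located words with domain in `[0, ℓ)`. -/
def AgreeBelow {A C : Type*} (f g : (ℕ → Option A) → C) (ℓ : ℕ) : Prop :=
  ∀ q : ℕ → Option A, IsLW q → domBelow q ℓ → f q = g q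

/-- Closedness of a class in `C^{FIN_A}` with the product topology (`C` discrete):
a class is closed iff it contains every coloring all of whose finite restrictions
(to located words with domain in `[0, ℓ)`, for each `ℓ`) are matched within the class. -/
def IsClosedColl {A C : Type*} (𝓒 : Set ((ℕ → Option A) → C)) : Prop :=
  ∀ f, (∀ ℓ : ℕ, ∃ g ∈ 𝓒, AgreeBelow f g ℓ) → f ∈ 𝓒

/-- A subshift: a nonempty closed class `𝓒 ⊆ C^{FIN_A}` such that for every `f ∈ 𝓒`,
`ℓ ∈ ℕ` and `p ∈ FIN_A(ℓ, ∞)` there is `g ∈ 𝓒` with `S^ℓ(g) = S^ℓ_p(f)`. -/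
def IsSubshift {A C : Type*} (𝓒 : Set ((ℕ → Option A) → C)) : Prop :=
  𝓒.Nonempty ∧ IsClosedColl 𝓒 ∧
    ∀ f ∈ 𝓒, ∀ ℓ : ℕ, ∀ p : ℕ → Option A, IsLW p → domAbove p ℓ →
      ∃ g ∈ 𝓒, SEq g f ℓ emptyW p

/-- A minimal subshift: no subshift is a proper subset of it. -/
def IsMinimalSubshift {A C : Type*} (𝓒 : Set ((ℕ → Option A) → C)) : Prop :=
  IsSubshift 𝓒 ∧ ∀ 𝓓 : Set ((ℕ → Option A) → C), IsSubshift 𝓓 → 𝓓 ⊆ 𝓒 → 𝓓 = 𝓒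

/-- The orbit closure of a coloring `f`: all `g` such that for every `ℓ` and every
`q ∈ FIN_A(ℓ, ∞)` there is `p ∈ FIN_A(ℓ, ∞)` with `S^ℓ_q(g) = S^ℓ_p(f)`. -/
def orbCl {A C : Type*} (f : (ℕ → Option A) → C) : Set ((ℕ → Option A) → C) :=
  { g | ∀ ℓ : ℕ, ∀ q : ℕ → Option A, IsLW q → domAbove q ℓ →
      ∃ p : ℕ → Option A, IsLW p ∧ domAbove p ℓ ∧ SEq g f ℓ q p }

/-- A variable word over `A`, encoded as a list over `Option A` with `none` = `⋆`:
the variable must occur at least once. -/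
def IsVarWord {A : Type*} (w : List (Option A)) : Prop := none ∈ w

/-- `w[a]`: replace every occurrence of the variable `⋆` by the letter `a`. -/
def substW {A : Type*} (w : List (Option A)) (a : A) : List A :=
  w.map fun x => x.getD a

/-- `⟨(w_n)_{n∈ℕ}⟩_A`: the words `w_{j₀}[a₀] ⋯ w_{j_{k-1}}[a_{k-1}]` extracted from
the sequence `(w_n)`, for `j₀ < ⋯ < j_{k-1}` and letters `a₀, …, a_{k-1} ∈ A`. -/
def extracted {A : Type*} (w : ℕ → List (Option A)) : Set (List A) :=
  { u | ∃ (k : ℕ) (j : Fin (k + 1) → ℕ) (a : Fin (k + 1) → A),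
      StrictMono j ∧ u = (List.ofFn fun i => substW (w (j i)) (a i)).flatten }

attribute [local instance] Ultrafilter.mul Ultrafilter.semigroup

section Semigroup

variable {M : Type*} [Semigroup M] [TopologicalSpace M] [CompactSpace M] [T2Space M]

/-- A nonempty closed subsemigroup `S` of a compact right topological semigroup contains a
minimal closed left ideal. -/
theorem exists_minimal_left_ideal (hc : ∀ r : M, Continuous (· * r)) {S : Set M}
    (hS : IsClosed S) (hne : S.Nonempty) (hmul : ∀ x ∈ S, ∀ y ∈ S, x * y ∈ S) :
    ∃ L ⊆ S, IsClosed L ∧ L.Nonempty ∧ (∀ s ∈ S, ∀ x ∈ L, s * x ∈ L) ∧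
      ∀ x ∈ L, ∀ y ∈ L, ∃ s ∈ S, s * x = y := by
  let I : Set (Set M) :=
    {L | L ⊆ S ∧ IsClosed L ∧ L.Nonempty ∧ ∀ s ∈ S, ∀ x ∈ L, s * x ∈ L}
  obtain ⟨L, -, hL⟩ : ∃ L ⊆ S, Minimal (· ∈ I) L := by
    refine zorn_superset_nonempty I (fun c hcI hch hcne => ?_) S
      ⟨subset_rfl, hS, hne, hmul⟩
    have := hcne.to_subtype
    obtain ⟨L₀, hL₀⟩ := hcne
    refine ⟨⋂₀ c, ⟨(Set.sInter_subset_of_mem hL₀).trans (hcI hL₀).1,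
      isClosed_sInter fun t ht => (hcI ht).2.1, ?_, fun s hs x hx t ht =>
        (hcI ht).2.2.2 s hs x (hx t ht)⟩, fun s hs => Set.sInter_subset_of_mem hs⟩
    exact IsCompact.nonempty_sInter_of_directed_nonempty_isCompact_isClosed
      (IsChain.directedOn hch.symm) (fun U hU => (hcI hU).2.2.1)
      (fun U hU => (hcI hU).2.1.isCompact) (fun U hU => (hcI hU).2.1)
  obtain ⟨hLS, hLc, hLne, hLI⟩ := hL.prop
  refine ⟨L, hLS, hLc, hLne, hLI, fun x hx y hy => ?_⟩
  have hsub : (· * x) '' S ⊆ L := by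
    rintro _ ⟨s, hs, rfl⟩
    exact hLI s hs x hx
  have heq : (· * x) '' S = L := by
    refine hL.eq_of_subset ⟨hsub.trans hLS, (hc x).isClosedMap _ hS, hne.image _, ?_⟩ hsub
    rintro s hs _ ⟨t, ht, rfl⟩
    exact ⟨s * t, hmul s hs t ht, mul_assoc _ _ _⟩
  rwa [← heq] at hy

/-- If `V` is a closed subsemigroup absorbing products with a closed subsemigroup `S` on both
sides, then some idempotent of `V` is sent to one fixed element of `S` by every homomorphism
that retracts `V` into `S`. -/
theorem exists_idempotent_forall_retract_eq (hc : ∀ r : M, Continuous (· * r)) {S V : Set M}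
    (hS : IsClosed S) (hSne : S.Nonempty) (hSS : ∀ x ∈ S, ∀ y ∈ S, x * y ∈ S)
    (hV : IsClosed V) (hVne : V.Nonempty) (hVV : ∀ x ∈ V, ∀ y ∈ V, x * y ∈ V)
    (hSV : ∀ x ∈ S, ∀ y ∈ V, x * y ∈ V) (hVS : ∀ x ∈ V, ∀ y ∈ S, x * y ∈ V) :
    ∃ u ∈ S, ∃ x ∈ V, x * x = x ∧
      ∀ φ : M →ₙ* M, (∀ y ∈ V, φ y ∈ S) → (∀ y ∈ S, φ y = y) → φ x = u := by
  obtain ⟨L, hLS, hLc, hLne, hLI, hLmin⟩ := exists_minimal_left_ideal hc hS hSne hSS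
  obtain ⟨u, huL, huu⟩ := exists_idempotent_in_compact_subsemigroup hc L hLne hLc.isCompact
    fun x hx y hy => hLI x (hLS hx) y hy
  have huS := hLS huL
  obtain ⟨_, ⟨y, hy, rfl⟩, hee⟩ := exists_idempotent_in_compact_subsemigroup hc ((· * u) '' V)
    (hVne.image _) ((hc u).isClosedMap _ hV).isCompact (by
      rintro _ ⟨y, hy, rfl⟩ _ ⟨z, hz, rfl⟩
      exact ⟨y * u * z, hVV _ (hVS y hy u huS) z hz, mul_assoc _ _ _⟩)
  have heu : y * u * u = y * u := by rw [mul_assoc, huu]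
  have hxx : u * (y * u) * (u * (y * u)) = u * (y * u) := by
    calc u * (y * u) * (u * (y * u)) = u * ((y * u * u) * (y * u)) := by simp only [mul_assoc]
      _ = u * (y * u) := by rw [heu]; exact congrArg (u * ·) hee
  refine ⟨u, huS, u * (y * u), hSV u huS _ (hVS y hy u huS), hxx, fun φ hφV hφS => ?_⟩
  set x := u * (y * u) with hx
  have hux : u * x = x := by rw [hx, ← mul_assoc, huu]
  have hxu : x * u = x := by rw [hx, mul_assoc, heu]
  have hv : φ x ∈ S := hφV x (hSV u huS _ (hVS y hy u huS))
  have huv : u * φ x = φ x := by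
    conv_rhs => rw [← hux, map_mul, hφS u huS]
  have hvu : φ x * u = φ x := by
    conv_rhs => rw [← hxu, map_mul, hφS u huS]
  have hvL : φ x ∈ L := hvu ▸ hLI _ hv u huL
  obtain ⟨w, -, hw⟩ := hLmin _ hvL u huL
  calc φ x = u * φ x := huv.symm
    _ = w * (φ x * φ x) := by rw [← mul_assoc, hw]
    _ = u := by rw [← map_mul, hxx, hw]

end Semigroup

/-- Pushforward of ultrafilters along a semigroup homomorphism is a homomorphism. -/
def ultrafilterMapHom {M N : Type*} [Semigroup M] [Semigroup N] (φ : M →ₙ* N) :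
    Ultrafilter M →ₙ* Ultrafilter N where
  toFun U := U.map φ
  map_mul' U V := Ultrafilter.coe_inj.mp <| Filter.ext' fun p => by
    simp [Ultrafilter.eventually_mul, Filter.eventually_map]

/-- Partial functions form a semigroup under left-biased union. -/
@[reducible] def punSemigroup (B : Type*) : Semigroup (ℕ → Option B) where
  mul := pun
  mul_assoc p q r := by
    funext n
    change pun (pun p q) r n = pun p (pun q r) n
    simp only [pun]
    cases p n <;> rfl

attribute [local instance] punSemigroup

/-- Substitution of a letter for the variable, as a semigroup homomorphism. -/
def substAHom {A : Type*} (a : A) : (ℕ → Option (Option A)) →ₙ* (ℕ → Option A) where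
  toFun p := substA p a
  map_mul' p q := by
    funext n
    change substA (pun p q) a n = pun (substA p a) (substA q a) n
    simp only [pun, substA]
    cases p n <;> rfl

/-- Regarding a word as a word over the extended alphabet, as a semigroup homomorphism. -/
def liftHom (A : Type*) : (ℕ → Option A) →ₙ* (ℕ → Option (Option A)) where
  toFun p n := (p n).map some
  map_mul' p q := by
    funext n
    change (pun p q n).map some = pun (fun n => (p n).map some) (fun n => (q n).map some) n
    simp only [pun]
    cases p n <;> rfl

theorem substA_liftHom {A : Type*} (a : A) (p : ℕ → Option A) : substA (liftHom A p) a = p := by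
  funext n
  change ((p n).map some).map _ = p n
  cases p n <;> rfl

theorem liftHom_substA {A : Type*} (a : A) {p : ℕ → Option (Option A)}
    (hp : ∀ n, p n ≠ some none) : liftHom A (substA p a) = p := by
  funext n
  change ((p n).map fun x => x.getD a).map some = p n
  have := hp n
  rcases h : p n with _ | _ | b <;> simp_all

theorem dom_substA {A : Type*} (p : ℕ → Option (Option A)) (a : A) : dom (substA p a) = dom p := by
  ext n
  simp [dom, substA]

theorem dom_liftHom {A : Type*} (p : ℕ → Option A) : dom (liftHom A p) = dom p := by
  ext n
  change (p n).map some ≠ none ↔ p n ≠ none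
  simp

theorem dom_pun {B : Type*} (p q : ℕ → Option B) : dom (pun p q) = dom p ∪ dom q := by
  ext n
  simp only [dom, pun, Set.mem_union, Set.mem_ofPred_eq]
  cases p n <;> simp

theorem pun_emptyW {B : Type*} (p : ℕ → Option B) : pun p emptyW = p := by
  funext n
  simp only [pun, emptyW]
  cases p n <;> rfl

theorem finite_domBelow {B : Type*} [Finite B] (l : ℕ) :
    {q : ℕ → Option B | domBelow q l}.Finite := by
  refine Set.Finite.of_finite_image (f := fun q (i : Fin l) => q i) (Set.toFinite _) ?_
  intro p hp q hq hpq
  funext n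
  by_cases hn : n < l
  · exact congrFun hpq ⟨n, hn⟩
  · have hpn : p n = none := by
      by_contra h
      exact hn (hp n h)
    have hqn : q n = none := by
      by_contra h
      exact hn (hq n h)
    rw [hpn, hqn]

/-- Ultrafilters concentrating on finite partial functions with domain arbitrarily far out. -/
def tailUltrafilters (B : Type*) : Set (Ultrafilter (ℕ → Option B)) :=
  {U | ∀ l : ℕ, ∀ᶠ p in (U : Filter (ℕ → Option B)), (dom p).Finite ∧ domAbove p l}

theorem isClosed_tailUltrafilters (B : Type*) : IsClosed (tailUltrafilters B) := by
  simp only [tailUltrafilters, Set.ofPred_forall]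
  exact isClosed_iInter fun l => ultrafilter_isClosed_basic _

theorem mul_mem_tailUltrafilters {B : Type*} {U V : Ultrafilter (ℕ → Option B)}
    (hU : U ∈ tailUltrafilters B) (hV : V ∈ tailUltrafilters B) :
    U * V ∈ tailUltrafilters B := by
  intro l
  rw [Ultrafilter.eventually_mul]
  filter_upwards [hU l] with p hp
  filter_upwards [hV l] with q hq
  change (dom (pun p q)).Finite ∧ ∀ n ∈ dom (pun p q), l ≤ n
  rw [dom_pun]
  exact ⟨hp.1.union hq.1, fun n hn => hn.elim (hp.2 n) (hq.2 n)⟩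

/-- Tail ultrafilters concentrating on variable words. -/
def variableUltrafilters (A : Type*) : Set (Ultrafilter (ℕ → Option (Option A))) :=
  tailUltrafilters (Option A) ∩
    {U | ∀ᶠ p in (U : Filter (ℕ → Option (Option A))), ∃ n, p n = some none}

/-- Tail ultrafilters concentrating on words without variable. -/
def constantUltrafilters (A : Type*) : Set (Ultrafilter (ℕ → Option (Option A))) :=
  tailUltrafilters (Option A) ∩
    {U | ∀ᶠ p in (U : Filter (ℕ → Option (Option A))), ∀ n, p n ≠ some none}

theorem mul_mem_variableUltrafilters_left {A : Type*} {U V : Ultrafilter (ℕ → Option (Option A))}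
    (hU : U ∈ variableUltrafilters A) (hV : V ∈ tailUltrafilters (Option A)) :
    U * V ∈ variableUltrafilters A := by
  refine ⟨mul_mem_tailUltrafilters hU.1 hV, (Ultrafilter.eventually_mul U V _).mpr ?_⟩
  filter_upwards [hU.2] with p ⟨n, hn⟩
  refine .of_forall fun q => ⟨n, ?_⟩
  change pun p q n = _
  simp [pun, hn]

theorem mul_mem_variableUltrafilters_right {A : Type*} {U V : Ultrafilter (ℕ → Option (Option A))}
    (hU : U ∈ tailUltrafilters (Option A)) (hV : V ∈ variableUltrafilters A) :
    U * V ∈ variableUltrafilters A := by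
  refine ⟨mul_mem_tailUltrafilters hU hV.1, (Ultrafilter.eventually_mul U V _).mpr ?_⟩
  filter_upwards [hU 0] with p hp
  obtain ⟨b, hb⟩ := hp.1.bddAbove
  filter_upwards [hV.1 (b + 1), hV.2] with q hq ⟨n, hn⟩
  refine ⟨n, ?_⟩
  have hbn : b + 1 ≤ n := hq.2 n (by simp [dom, hn])
  have hpn : p n = none := by
    by_contra h
    have : n ≤ b := hb h
    omega
  change pun p q n = _
  simp [pun, hn, hpn]

theorem mul_mem_constantUltrafilters {A : Type*} {U V : Ultrafilter (ℕ → Option (Option A))}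
    (hU : U ∈ constantUltrafilters A) (hV : V ∈ constantUltrafilters A) :
    U * V ∈ constantUltrafilters A := by
  refine ⟨mul_mem_tailUltrafilters hU.1 hV.1, (Ultrafilter.eventually_mul U V _).mpr ?_⟩
  filter_upwards [hU.2] with p hp
  filter_upwards [hV.2] with q hq n
  change pun p q n ≠ _
  have hpn := hp n
  simp only [pun]
  rcases h : p n with _ | b
  · exact hq n
  · simpa [h] using hpn

theorem variableUltrafilters_nonempty (A : Type*) : (variableUltrafilters A).Nonempty := by
  let s : ℕ → ℕ → Option (Option A) := fun m n => if n = m then some none else none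
  have hs : ∀ m, dom (s m) = {m} := fun m => by
    ext n
    simp [dom, s]
  refine ⟨(Filter.hyperfilter ℕ).map s, fun l => ?_, ?_⟩
  · have hl : ∀ᶠ m in (Filter.hyperfilter ℕ : Filter ℕ), l ≤ m :=
      Nat.hyperfilter_le_atTop (Filter.eventually_ge_atTop l)
    refine Filter.eventually_map.mpr (hl.mono fun m hm => ?_)
    simp [hs, domAbove, hm]
  · have : ∀ᶠ m in (Filter.hyperfilter ℕ : Filter ℕ), ∃ n, s m n = some none :=
      .of_forall fun m => ⟨m, by simp [s]⟩
    exact Filter.eventually_map.mpr this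

theorem constantUltrafilters_nonempty (A : Type*) : (constantUltrafilters A).Nonempty :=
  ⟨pure emptyW, fun l => Filter.eventually_pure.mpr (by simp [dom, domAbove, emptyW]),
    Filter.eventually_pure.mpr fun _ h => nomatch h⟩

/-- There is an idempotent ultrafilter of located variable words all of whose substitution
instances are one and the same ultrafilter. -/
theorem exists_idempotent_variableUltrafilter (A : Type*) [Nonempty A] :
    ∃ U ∈ variableUltrafilters A, U * U = U ∧
      ∃ W : Ultrafilter (ℕ → Option A), ∀ a : A, U.map (substAHom a) = W := by
  obtain ⟨u, -, U, hU, hUU, h⟩ := exists_idempotent_forall_retract_eq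
    (S := constantUltrafilters A) (V := variableUltrafilters A) Ultrafilter.continuous_mul_left
    ((isClosed_tailUltrafilters _).inter (ultrafilter_isClosed_basic _))
    (constantUltrafilters_nonempty A) (fun _ hx _ hy => mul_mem_constantUltrafilters hx hy)
    ((isClosed_tailUltrafilters _).inter (ultrafilter_isClosed_basic _))
    (variableUltrafilters_nonempty A) (fun _ hx _ hy => mul_mem_variableUltrafilters_left hx hy.1)
    (fun _ hx _ hy => mul_mem_variableUltrafilters_right hx.1 hy)
    (fun _ hx _ hy => mul_mem_variableUltrafilters_left hx hy.1)
  have hmap : ∀ a : A, (U.map (substAHom a)).map (liftHom A) = u := fun a => by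
    refine h (ultrafilterMapHom ((liftHom A).comp (substAHom a))) (fun V hV => ⟨fun l => ?_, ?_⟩)
      fun V hV => ?_
    · refine Filter.eventually_map.mpr ((hV.1 l).mono fun p hp => ?_)
      have hd : dom (liftHom A (substA p a)) = dom p := by rw [dom_liftHom, dom_substA]
      change (dom (liftHom A (substA p a))).Finite ∧ ∀ n ∈ dom (liftHom A (substA p a)), l ≤ n
      rw [hd]
      exact hp
    · refine Filter.eventually_map.mpr (.of_forall fun p n => ?_)
      change (substA p a n).map some ≠ some none
      simp
    · refine Ultrafilter.coe_inj.mp ((Filter.map_congr ?_).trans Filter.map_id)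
      exact hV.2.mono fun p hp => liftHom_substA a hp
  refine ⟨U, hU, hUU, u.map (substAHom (Classical.arbitrary A)), fun a => ?_⟩
  rw [← hmap a, Ultrafilter.map_map]
  have : substAHom (Classical.arbitrary A) ∘ liftHom A = id := funext fun p => substA_liftHom _ p
  rw [this, Ultrafilter.map_id]

/-- Every function to a finite type is eventually constant along an ultrafilter. -/
theorem exists_eventually_eq {α C : Type*} [Finite C] (U : Ultrafilter α) (f : α → C) :
    ∃ c, ∀ᶠ x in U, f x = c := by
  obtain ⟨c, hc⟩ := Ultrafilter.eq_pure_of_finite (U.map f)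
  refine ⟨c, ?_⟩
  have : ∀ᶠ y in (U.map f : Filter C), y = c := by
    rw [hc]
    exact Filter.eventually_pure.mpr rfl
  exact Filter.eventually_map.mp this

/-- Weak Auslander–Ellis theorem for `C^{FIN_A}`: for every coloring `f : FIN_A → C`
there is a coloring `g : FIN_A → C` strongly proximal to `f`. -/
theorem weak_auslander_ellis_located_words {A C : Type*} [Fintype A] [Nonempty A] [Fintype C]
    (f : (ℕ → Option A) → C) :
    ∃ g : (ℕ → Option A) → C, StrongProx g f := by
  obtain ⟨U, hU, hUU, W, hW⟩ := exists_idempotent_variableUltrafilter A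
  have hWW : W * W = W := by
    have := map_mul (ultrafilterMapHom (substAHom (Classical.arbitrary A))) U U
    rw [hUU] at this
    change U.map _ = U.map _ * U.map _ at this
    rw [hW] at this
    exact this.symm
  choose g hg using fun q : ℕ → Option A =>
    exists_eventually_eq W fun p : ℕ → Option A => f (pun q p)
  have hgg : ∀ q, ∀ᶠ p in W, g (pun q p) = g q := fun q => by
    have h := hg q
    rw [← hWW, Ultrafilter.eventually_mul] at h
    filter_upwards [h] with p hp
    obtain ⟨r, hr, hr'⟩ := (hp.and (hg (pun q p))).exists
    rw [← hr, ← hr']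
    exact congrArg f (mul_assoc q p r)
  refine ⟨g, fun l => ?_⟩
  have hl : ∀ᶠ p in W, ∀ q ∈ {q : ℕ → Option A | domBelow q l},
      g (pun q p) = g q ∧ f (pun q p) = g q :=
    (Filter.eventually_all_finite (finite_domBelow l)).mpr fun q _ => (hgg q).and (hg q)
  have hl' : ∀ᶠ p in U, ∀ a : A, ∀ q ∈ {q : ℕ → Option A | domBelow q l},
      g (pun q (substA p a)) = g q ∧ f (pun q (substA p a)) = g q := by
    refine Filter.eventually_all.mpr fun a => ?_
    rw [← hW a] at hl
    exact Filter.eventually_map.mp hl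
  obtain ⟨p, ⟨hpfin, hpl⟩, ⟨n, hn⟩, hp⟩ := ((hU.1 l).and (hU.2.and hl')).exists
  refine ⟨p, ⟨⟨hpfin, n, by simp [dom, hn]⟩, n, hn⟩, hpl, fun a => ⟨fun q _ hq => ?_,
    fun q _ hq => ?_⟩⟩
  · rw [pun_emptyW, (hp a q hq).1]
  · rw [(hp a q hq).1, (hp a q hq).2]

end Carlson
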